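/- arXiv:1511.02733 — 2 statements merged into one kernel-verified Lean document; each statement's English description precedes it below -/
import Mathlib

section
/- Pull-back of a Hamiltonian-dissipative vector field by an exact-symplectic transformation (Lemma 4.2). Let η ∈ ℝ, let φ : ℝⁿ → ℝⁿ be a C² diffeomorphism, S : ℝⁿ → ℝ of class C², and H : ℝⁿ×ℝⁿ → ℝ of class C². Define g(θ,r) = (φ(θ), (Dφ(θ)ᵀ)⁻¹·(r + ∇S(θ))) and v(θ,r) = (∇_r H(θ,r), −∇_θ H(θ,r) − ηr). Then the pull-back g*v := (Dg)⁻¹·(v∘g) is given, at every point (θ,r), by g*v(θ,r) = (∇_r Ĥ(θ,r), −∇_θ Ĥ(θ,r) − ηr), where Ĥ(θ,r) = H(g(θ,r)) + η·S(θ). -/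
open scoped RealInnerProductSpace

section SymplecticPullback

variable {E : Type*} [NormedAddCommGroup E] [InnerProductSpace ℝ E]

/-- The standard symplectic form on `E × E`. -/
def stdSymplecticForm (u w : E × E) : ℝ := ⟪u.2, w.1⟫ - ⟪w.2, u.1⟫

theorem stdSymplecticForm_ext {u w : E × E}
    (h : ∀ z, stdSymplecticForm u z = stdSymplecticForm w z) : u = w := by
  refine Prod.ext (ext_inner_left ℝ fun x => ?_) (ext_inner_right ℝ fun x => ?_)
  · simpa [stdSymplecticForm] using h (0, x)
  · simpa [stdSymplecticForm] using h (x, 0)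

/-- A symplectic endomorphism `L` is invertible, and `L⁻¹ v` is determined by pairing `v`
with the range of `L`. -/
theorem inverse_apply_eq_of_stdSymplecticForm [FiniteDimensional ℝ E]
    {L : E × E →L[ℝ] E × E}
    (hL : ∀ u z, stdSymplecticForm (L u) (L z) = stdSymplecticForm u z) {v w : E × E}
    (h : ∀ z, stdSymplecticForm v (L z) = stdSymplecticForm w z) : L.inverse v = w := by
  have hinj : Function.Injective (L : E × E →ₗ[ℝ] E × E) := fun a b hab =>
    stdSymplecticForm_ext fun z => by
      rw [← hL a z, ← hL b z, show L a = L b from hab]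
  let e : (E × E) ≃L[ℝ] (E × E) :=
    (LinearEquiv.ofInjectiveEndo (L : E × E →ₗ[ℝ] E × E) hinj).toContinuousLinearEquiv
  have he : (e : E × E →L[ℝ] E × E) = L := by ext x <;> rfl
  have hv : L (e.symm v) = v := by
    rw [← he]
    exact e.apply_symm_apply v
  rw [← he, ContinuousLinearMap.inverse_equiv]
  refine stdSymplecticForm_ext fun z => ?_
  rw [← h z, ← hL, ContinuousLinearEquiv.coe_coe, hv]

/-- A map `(θ, r) ↦ (φ θ, R (θ, r))` with `Dφ(θ)ᵀ R = r + ∇S(θ)` is symplectic. -/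
theorem stdSymplecticForm_fderiv_exact {φ : E → E} {S : E → ℝ} {R : E × E → E}
    (hφ : ContDiff ℝ 2 φ) (hS : ContDiff ℝ 2 S) (hR : Differentiable ℝ R)
    (hRφ : ∀ p c, ⟪R p, fderiv ℝ φ p.1 c⟫ = ⟪p.2, c⟫ + fderiv ℝ S p.1 c) (p u z : E × E) :
    stdSymplecticForm (fderiv ℝ (fun p => (φ p.1, R p)) p u)
      (fderiv ℝ (fun p => (φ p.1, R p)) p z) = stdSymplecticForm u z := by
  have hφ' : Differentiable ℝ (fderiv ℝ φ) :=
    (hφ.fderiv_right (m := 1) (by norm_num)).differentiable one_ne_zero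
  have hS' : Differentiable ℝ (fderiv ℝ S) :=
    (hS.fderiv_right (m := 1) (by norm_num)).differentiable one_ne_zero
  have hG : HasFDerivAt (fun p : E × E => (φ p.1, R p))
      (((fderiv ℝ φ p.1).comp (ContinuousLinearMap.fst ℝ E E)).prod (fderiv ℝ R p)) p :=
    (HasFDerivAt.comp (g := φ) p (hφ.differentiable two_ne_zero p.1).hasFDerivAt
      hasFDerivAt_fst).prodMk (hR p).hasFDerivAt
  have key : ∀ (w : E × E) (c : E),
      ⟪fderiv ℝ R p w, fderiv ℝ φ p.1 c⟫ =
        ⟪w.2, c⟫ + fderiv ℝ (fderiv ℝ S) p.1 w.1 c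
          - ⟪R p, fderiv ℝ (fderiv ℝ φ) p.1 w.1 c⟫ := by
    intro w c
    have hB : HasFDerivAt (fun q : E × E => fderiv ℝ φ q.1)
        ((fderiv ℝ (fderiv ℝ φ) p.1).comp (ContinuousLinearMap.fst ℝ E E)) p :=
      HasFDerivAt.comp (g := fderiv ℝ φ) p (hφ' p.1).hasFDerivAt hasFDerivAt_fst
    have hT : HasFDerivAt (fun q : E × E => fderiv ℝ S q.1)
        ((fderiv ℝ (fderiv ℝ S) p.1).comp (ContinuousLinearMap.fst ℝ E E)) p :=
      HasFDerivAt.comp (g := fderiv ℝ S) p (hS' p.1).hasFDerivAt hasFDerivAt_fst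
    have hl := (hR p).hasFDerivAt.inner ℝ (hB.clm_apply (hasFDerivAt_const c p))
    have hr := ((hasFDerivAt_snd (p := p)).inner ℝ (hasFDerivAt_const c p)).add
      (hT.clm_apply (hasFDerivAt_const c p))
    have heq := congrArg (fun L => L w) (hl.unique (hr.congr_of_eventuallyEq
      (Filter.Eventually.of_forall fun q => hRφ q c)))
    simp at heq
    linarith
  have hsymφ := (hφ.contDiffAt (x := p.1)).isSymmSndFDerivAt (by simp) u.1 z.1
  have hsymS := (hS.contDiffAt (x := p.1)).isSymmSndFDerivAt (by simp) u.1 z.1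
  simp only [hG.fderiv, stdSymplecticForm, ContinuousLinearMap.prod_apply,
    ContinuousLinearMap.comp_apply, ContinuousLinearMap.coe_fst', key, hsymφ, hsymS]
  ring

variable [FiniteDimensional ℝ E]

theorem inner_gradient_eq_fderiv (f : E → ℝ) (x c : E) :
    ⟪gradient f x, c⟫ = fderiv ℝ f x c := by
  simp [gradient]

theorem stdSymplecticForm_hamiltonian_dissipative {H : E × E → ℝ} {p : E × E}
    (hH : DifferentiableAt ℝ H p) (η : ℝ) (z : E × E) :
    stdSymplecticForm (gradient (fun r => H (p.1, r)) p.2,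
      -gradient (fun θ => H (θ, p.2)) p.1 - η • p.2) z =
      -fderiv ℝ H p z - η * ⟪p.2, z.1⟫ := by
  have h₁ : HasFDerivAt (fun θ => H (θ, p.2))
      ((fderiv ℝ H p).comp (ContinuousLinearMap.inl ℝ E E)) p.1 :=
    HasFDerivAt.comp (g := H) p.1 hH.hasFDerivAt (hasFDerivAt_prodMk_left p.1 p.2)
  have h₂ : HasFDerivAt (fun r => H (p.1, r))
      ((fderiv ℝ H p).comp (ContinuousLinearMap.inr ℝ E E)) p.2 :=
    HasFDerivAt.comp (g := H) p.2 hH.hasFDerivAt (hasFDerivAt_prodMk_right p.1 p.2)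
  have hz : fderiv ℝ H p z = fderiv ℝ H p (z.1, 0) + fderiv ℝ H p (0, z.2) := by
    rw [← map_add]
    simp
  simp only [stdSymplecticForm, inner_sub_left, inner_neg_left, real_inner_smul_left,
    inner_gradient_eq_fderiv, real_inner_comm (gradient _ _) z.2, h₁.fderiv, h₂.fderiv, hz,
    ContinuousLinearMap.comp_apply, ContinuousLinearMap.inl_apply,
    ContinuousLinearMap.inr_apply]
  ring

theorem differentiable_of_inner {F : Type*} [NormedAddCommGroup F] [NormedSpace ℝ F]
    {f : F → E} (h : ∀ c, Differentiable ℝ fun x => ⟪f x, c⟫) : Differentiable ℝ f := by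
  have hf : f = fun x => ∑ i, ⟪f x, stdOrthonormalBasis ℝ E i⟫ • stdOrthonormalBasis ℝ E i := by
    funext x
    simp only [real_inner_comm (stdOrthonormalBasis ℝ E _) (f x)]
    exact ((stdOrthonormalBasis ℝ E).sum_repr' (f x)).symm
  rw [hf]
  exact Differentiable.fun_sum fun i _ => (h _).smul_const _

end SymplecticPullback


/-- **Lemma 4.2** (pull-back of a Hamiltonian-dissipative vector field by an
exact-symplectic transformation).  With `g(θ,r) = (φ(θ), (Dφ(θ)ᵀ)⁻¹(r + ∇S(θ)))` and
`v(θ,r) = (∇_r H, −∇_θ H − ηr)`, the pull-back `g*v = (Dg)⁻¹(v∘g)` is the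
Hamiltonian-dissipative vector field of `Ĥ(θ,r) = H(g(θ,r)) + η S(θ)`:
`g*v(θ,r) = (∇_r Ĥ, −∇_θ Ĥ − ηr)`.  Here `A θ` is the inverse of the transposed
Jacobian `Dφ(θ)ᵀ` (the adjoint of `fderiv ℝ φ θ`), and `(fderiv ℝ G p).inverse` is the
inverse of the Jacobian of `g`. -/
theorem pullback_hamiltonian_dissipative (n : ℕ) (η : ℝ)
    (φv ψv : EuclideanSpace ℝ (Fin n) → EuclideanSpace ℝ (Fin n))
    (hφ : ContDiff ℝ 2 φv) (hψ : ContDiff ℝ 2 ψv)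
    (hlr : Function.LeftInverse ψv φv) (hrl : Function.RightInverse ψv φv)
    (S : EuclideanSpace ℝ (Fin n) → ℝ) (hS : ContDiff ℝ 2 S)
    (H : EuclideanSpace ℝ (Fin n) × EuclideanSpace ℝ (Fin n) → ℝ) (hH : ContDiff ℝ 2 H)
    (A : EuclideanSpace ℝ (Fin n) → EuclideanSpace ℝ (Fin n) →L[ℝ] EuclideanSpace ℝ (Fin n))
    (hA₁ : ∀ θ, (A θ).comp (ContinuousLinearMap.adjoint (fderiv ℝ φv θ)) =
      ContinuousLinearMap.id ℝ (EuclideanSpace ℝ (Fin n)))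
    (hA₂ : ∀ θ, (ContinuousLinearMap.adjoint (fderiv ℝ φv θ)).comp (A θ) =
      ContinuousLinearMap.id ℝ (EuclideanSpace ℝ (Fin n)))
    (G V : EuclideanSpace ℝ (Fin n) × EuclideanSpace ℝ (Fin n) →
      EuclideanSpace ℝ (Fin n) × EuclideanSpace ℝ (Fin n))
    (hG : G = fun p => (φv p.1, A p.1 (p.2 + gradient S p.1)))
    (hV : V = fun p => (gradient (fun r => H (p.1, r)) p.2,
      -gradient (fun θ => H (θ, p.2)) p.1 - η • p.2))
    (Hhat : EuclideanSpace ℝ (Fin n) × EuclideanSpace ℝ (Fin n) → ℝ)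
    (hHhat : Hhat = fun p => H (G p) + η * S p.1) :
    ∀ p : EuclideanSpace ℝ (Fin n) × EuclideanSpace ℝ (Fin n),
      (fderiv ℝ G p).inverse (V (G p)) =
        (gradient (fun r => Hhat (p.1, r)) p.2,
          -gradient (fun θ => Hhat (θ, p.2)) p.1 - η • p.2) := by
  intro p
  set R : EuclideanSpace ℝ (Fin n) × EuclideanSpace ℝ (Fin n) → EuclideanSpace ℝ (Fin n) :=
    fun p => A p.1 (p.2 + gradient S p.1) with hRdef
  have hRφ : ∀ p c, ⟪R p, fderiv ℝ φv p.1 c⟫ = ⟪p.2, c⟫ + fderiv ℝ S p.1 c := by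
    intro p c
    rw [← ContinuousLinearMap.adjoint_inner_left, hRdef, ← ContinuousLinearMap.comp_apply,
      hA₂, ContinuousLinearMap.id_apply, inner_add_left, inner_gradient_eq_fderiv]
  have hφd : Differentiable ℝ φv := hφ.differentiable two_ne_zero
  have hψd : Differentiable ℝ ψv := hψ.differentiable two_ne_zero
  have hψ' : Differentiable ℝ (fderiv ℝ ψv) :=
    (hψ.fderiv_right (m := 1) (by norm_num)).differentiable one_ne_zero
  have hS' : Differentiable ℝ (fderiv ℝ S) :=
    (hS.fderiv_right (m := 1) (by norm_num)).differentiable one_ne_zero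
  have hinv : ∀ θ c, fderiv ℝ φv θ (fderiv ℝ ψv (φv θ) c) = c := by
    intro θ c
    have h := (hφd (ψv (φv θ))).hasFDerivAt.comp (φv θ) (hψd (φv θ)).hasFDerivAt
    rw [hrl.comp_eq_id, hlr θ] at h
    exact congrArg (fun L => L c) (h.unique (hasFDerivAt_id (φv θ)))
  have hR : Differentiable ℝ R := by
    refine differentiable_of_inner fun c => ?_
    have hc : (fun p => ⟪R p, c⟫) = fun p => ⟪p.2, fderiv ℝ ψv (φv p.1) c⟫ +
        fderiv ℝ S p.1 (fderiv ℝ ψv (φv p.1) c) := by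
      funext p
      rw [← hRφ, hinv]
    have hψφ : Differentiable ℝ
        fun p : EuclideanSpace ℝ (Fin n) × EuclideanSpace ℝ (Fin n) =>
          fderiv ℝ ψv (φv p.1) c :=
      ((hψ'.comp hφd).comp differentiable_fst).clm_apply (differentiable_const c)
    rw [hc]
    exact (differentiable_snd.inner ℝ hψφ).add ((hS'.comp differentiable_fst).clm_apply hψφ)
  have hGR : G = fun p => (φv p.1, R p) := hG
  have hGd : Differentiable ℝ G := by
    rw [hGR]
    exact (hφd.comp differentiable_fst).prodMk hR
  have hHd : Differentiable ℝ H := hH.differentiable two_ne_zero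
  have hHhat' : HasFDerivAt Hhat ((fderiv ℝ H (G p)).comp (fderiv ℝ G p) +
      η • (fderiv ℝ S p.1).comp (ContinuousLinearMap.fst ℝ _ _)) p := by
    rw [hHhat]
    exact (HasFDerivAt.comp (g := H) p (hHd (G p)).hasFDerivAt (hGd p).hasFDerivAt).add
      ((HasFDerivAt.comp (g := S) p (hS.differentiable two_ne_zero p.1).hasFDerivAt
        hasFDerivAt_fst).const_mul η)
  have hG₁ : ∀ z, (fderiv ℝ G p z).1 = fderiv ℝ φv p.1 z.1 := by
    intro z
    have h := (HasFDerivAt.comp (g := φv) p (hφd p.1).hasFDerivAt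
      (hasFDerivAt_fst (𝕜 := ℝ))).prodMk (hR p).hasFDerivAt
    rw [hGR]
    exact congrArg (fun L => (L z).1) h.fderiv
  refine inverse_apply_eq_of_stdSymplecticForm (fun u z => ?_) fun z => ?_
  · rw [hGR]
    exact stdSymplecticForm_fderiv_exact hφ hS hR hRφ p u z
  · have hG₂ : (G p).2 = R p := by rw [hGR]
    rw [hV, stdSymplecticForm_hamiltonian_dissipative (hHd (G p)),
      stdSymplecticForm_hamiltonian_dissipative hHhat'.differentiableAt, hHhat'.fderiv,
      hG₁, hG₂, hRφ]
    simp
    ring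
end

section
/- Inversion of a periodic holomorphism of a complex strip (Theorem B.1, lifted form). Let 0 < 2σ < s and let (v_k)_{k∈ℤⁿ} be a family of vectors of ℂⁿ with |v|_s := Σ_{k∈ℤⁿ} ‖v_k‖_∞ · e^{|k|s} < σ/n. For z in the closed strip S_t = {z ∈ ℂⁿ : max_j |Im z_j| ≤ t} (t ≤ s) define v(z) = Σ_{k∈ℤⁿ} v_k e^{i k·z} (the series converges absolutely). Then: (i) the map φ = id + v is injective on S_{s−σ}; (ii) for every y ∈ S_{s−2σ} there exists a unique x ∈ S_{s−σ} with φ(x) = y; (iii) the resulting inverse ψ : S_{s−2σ} → S_{s−σ} satisfies ψ(y + 2πk) = ψ(y) + 2πk for all k ∈ ℤⁿ, and sup_{y∈S_{s−2σ}} ‖ψ(y) − y‖_∞ ≤ |v|_{s−σ}; (iv) if moreover |v|_s < σ/(2n), then ψ is holomorphic on the interior of S_{s−2σ} and sup ‖Dψ(y) − Id‖ ≤ (2/σ)·|v|_s there. -/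
open scoped BigOperators ENNReal

/-- The ℓ¹-norm `|k| = |k₁| + ⋯ + |kₙ|` of a multi-integer `k ∈ ℤⁿ`. -/
noncomputable def knorm {n : ℕ} (k : Fin n → ℤ) : ℝ := ∑ j, |(k j : ℝ)|

/-- The weighted norm `|v|_t = Σ_k ‖v_k‖_∞ e^{|k|t} ∈ [0,∞]` of a family of vectors of
`ℂⁿ` (the norm on `Fin n → ℂ` is the sup norm `‖·‖_∞`). -/
noncomputable def vwnorm {n : ℕ} (t : ℝ) (v : (Fin n → ℤ) → Fin n → ℂ) : ℝ≥0∞ :=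
  ∑' k : Fin n → ℤ, (‖v k‖₊ : ℝ≥0∞) * ENNReal.ofReal (Real.exp (knorm k * t))

/-- The closed strip `S_t = {z ∈ ℂⁿ : max_j |Im z_j| ≤ t}`. -/
def strip (n : ℕ) (t : ℝ) : Set (Fin n → ℂ) := {z | ∀ j, |(z j).im| ≤ t}

/-- The open strip `{z ∈ ℂⁿ : max_j |Im z_j| < t}`. -/
def ostrip (n : ℕ) (t : ℝ) : Set (Fin n → ℂ) := {z | ∀ j, |(z j).im| < t}

/-- The sum `v(z) = Σ_k v_k e^{i k·z}` of the Fourier series with coefficients `v_k`. -/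
noncomputable def fseries {n : ℕ} (v : (Fin n → ℤ) → Fin n → ℂ) (z : Fin n → ℂ) :
    Fin n → ℂ :=
  ∑' k : Fin n → ℤ, Complex.exp (Complex.I * ∑ j, (k j : ℂ) * z j) • v k

section Weights

variable {n : ℕ}

lemma knorm_nonneg (k : Fin n → ℤ) : 0 ≤ knorm k :=
  Finset.sum_nonneg fun _ _ => abs_nonneg _

lemma vwnorm_term_toReal (t : ℝ) (k : Fin n → ℤ) (w : Fin n → ℂ) :
    ((‖w‖₊ : ℝ≥0∞) * ENNReal.ofReal (Real.exp (knorm k * t))).toReal =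
      ‖w‖ * Real.exp (knorm k * t) := by
  rw [ENNReal.toReal_mul, ENNReal.toReal_ofReal (Real.exp_pos _).le, ENNReal.coe_toReal, coe_nnnorm]

lemma hasSum_vwnorm {t : ℝ} {v : (Fin n → ℤ) → Fin n → ℂ} (h : vwnorm t v ≠ ⊤) :
    HasSum (fun k => ‖v k‖ * Real.exp (knorm k * t)) (vwnorm t v).toReal := by
  have hs := ENNReal.summable_toReal h
  have ht : (vwnorm t v).toReal = ∑' k, ‖v k‖ * Real.exp (knorm k * t) := by
    unfold vwnorm
    rw [ENNReal.tsum_toReal_eq fun k => ENNReal.mul_ne_top ENNReal.coe_ne_top ENNReal.ofReal_ne_top]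
    simp only [vwnorm_term_toReal]
  simp only [vwnorm_term_toReal] at hs
  exact ht ▸ hs.hasSum

lemma vwnorm_mono {t t' : ℝ} (h : t ≤ t') (v : (Fin n → ℤ) → Fin n → ℂ) :
    vwnorm t v ≤ vwnorm t' v := by
  unfold vwnorm
  have := knorm_nonneg (n := n)
  gcongr with k
  exact this k

lemma knorm_mul_exp_le {s σ : ℝ} (hσ : 0 < σ) (k : Fin n → ℤ) :
    knorm k * Real.exp (knorm k * (s - σ)) ≤ Real.exp (knorm k * s) / σ := by
  rw [le_div_iff₀ hσ]
  have h1 : knorm k * σ ≤ Real.exp (knorm k * σ) := by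
    linarith [Real.add_one_le_exp (knorm k * σ)]
  calc knorm k * Real.exp (knorm k * (s - σ)) * σ
      = (knorm k * σ) * Real.exp (knorm k * (s - σ)) := by ring
    _ ≤ Real.exp (knorm k * σ) * Real.exp (knorm k * (s - σ)) := by gcongr
    _ = Real.exp (knorm k * s) := by rw [← Real.exp_add]; ring_nf

end Weights

section Strips

variable {n : ℕ} {t : ℝ}

lemma ostrip_subset_strip : ostrip n t ⊆ strip n t := fun _ hz j => (hz j).le

lemma isClosed_strip : IsClosed (strip n t) := by
  simp only [strip, Set.ofPred_forall]
  exact isClosed_iInter fun j => isClosed_le (by fun_prop) continuous_const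

lemma isOpen_ostrip : IsOpen (ostrip n t) := by
  simp only [ostrip, Set.ofPred_forall]
  exact isOpen_iInter_of_finite fun j => isOpen_lt (by fun_prop) continuous_const

lemma abs_im_convex_combination (z w : Fin n → ℂ) (a b : ℝ) (ha : 0 ≤ a) (hb : 0 ≤ b) (j : Fin n) :
    |((a • z + b • w) j).im| ≤ a * |(z j).im| + b * |(w j).im| := by
  simpa [abs_mul, abs_of_nonneg ha, abs_of_nonneg hb] using
    abs_add_le (a * (z j).im) (b * (w j).im)

lemma convex_strip : Convex ℝ (strip n t) := by
  intro z hz w hw a b ha hb hab j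
  calc _ ≤ a * |(z j).im| + b * |(w j).im| := abs_im_convex_combination z w a b ha hb j
    _ ≤ a * t + b * t := by gcongr <;> apply_assumption
    _ = t := by rw [← add_mul, hab, one_mul]

lemma convex_ostrip : Convex ℝ (ostrip n t) := by
  intro z hz w hw a b ha hb hab j
  have hmax : max |(z j).im| |(w j).im| < t := max_lt (hz j) (hw j)
  calc _ ≤ a * |(z j).im| + b * |(w j).im| := abs_im_convex_combination z w a b ha hb j
    _ ≤ a * max |(z j).im| |(w j).im| + b * max |(z j).im| |(w j).im| := by
        gcongr; exacts [le_max_left _ _, le_max_right _ _]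
    _ = max |(z j).im| |(w j).im| := by rw [← add_mul, hab, one_mul]
    _ < t := hmax

lemma abs_im_le_abs_im_add_norm_sub (x y : Fin n → ℂ) (j : Fin n) :
    |(x j).im| ≤ |(y j).im| + ‖x - y‖ := by
  have h1 : |((x - y) j).im| ≤ ‖x - y‖ := (Complex.abs_im_le_norm _).trans (norm_le_pi_norm _ j)
  have h2 := abs_add_le (y j).im ((x - y) j).im
  rw [show (y j).im + ((x - y) j).im = (x j).im by simp] at h2
  linarith

end Strips

section FourierModes

variable {n : ℕ}

/-- The linear form `z ↦ k·z`. -/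
noncomputable def freqForm (k : Fin n → ℤ) : (Fin n → ℂ) →L[ℂ] ℂ :=
  ∑ j, (k j : ℂ) • ContinuousLinearMap.proj j

/-- The vector-valued Fourier mode `z ↦ e^{i k·z} v_k`. -/
noncomputable def fmode (v : (Fin n → ℤ) → Fin n → ℂ) (k : Fin n → ℤ) (z : Fin n → ℂ) :
    Fin n → ℂ :=
  Complex.exp (Complex.I * freqForm k z) • v k

/-- The derivative of `fmode v k`. -/
noncomputable def fmodeDeriv (v : (Fin n → ℤ) → Fin n → ℂ) (k : Fin n → ℤ) (z : Fin n → ℂ) :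
    (Fin n → ℂ) →L[ℂ] (Fin n → ℂ) :=
  (Complex.exp (Complex.I * freqForm k z) • Complex.I • freqForm k).smulRight (v k)

lemma freqForm_apply (k : Fin n → ℤ) (z : Fin n → ℂ) : freqForm k z = ∑ j, (k j : ℂ) * z j := by
  simp [freqForm]

lemma fseries_eq_tsum_fmode (v : (Fin n → ℤ) → Fin n → ℂ) (z : Fin n → ℂ) :
    fseries v z = ∑' k, fmode v k z := by
  simp only [fseries, fmode, freqForm_apply]

lemma norm_freqForm_le (k : Fin n → ℤ) : ‖freqForm k‖ ≤ knorm k := by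
  refine ContinuousLinearMap.opNorm_le_bound _ (knorm_nonneg k) fun z => ?_
  rw [freqForm_apply, knorm, Finset.sum_mul]
  refine norm_sum_le_of_le _ fun j _ => ?_
  rw [norm_mul, Complex.norm_intCast]
  gcongr
  exact norm_le_pi_norm z j

lemma norm_exp_freqForm_le {t : ℝ} (k : Fin n → ℤ) {z : Fin n → ℂ} (hz : z ∈ strip n t) :
    ‖Complex.exp (Complex.I * freqForm k z)‖ ≤ Real.exp (knorm k * t) := by
  rw [Complex.norm_exp]
  gcongr
  simp only [freqForm_apply, Complex.I_mul_re, Complex.im_sum, ← Finset.sum_neg_distrib, knorm,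
    Finset.sum_mul]
  refine Finset.sum_le_sum fun j _ => ?_
  have h : (((k j : ℤ) : ℂ) * z j).im = (k j : ℝ) * (z j).im := by simp
  rw [h]
  calc -((k j : ℝ) * (z j).im) ≤ |(k j : ℝ) * (z j).im| := neg_le_abs _
    _ = |(k j : ℝ)| * |(z j).im| := abs_mul _ _
    _ ≤ |(k j : ℝ)| * t := by gcongr; exact hz j

lemma norm_fmode_le {t : ℝ} (v : (Fin n → ℤ) → Fin n → ℂ) (k : Fin n → ℤ) {z : Fin n → ℂ}
    (hz : z ∈ strip n t) : ‖fmode v k z‖ ≤ ‖v k‖ * Real.exp (knorm k * t) := by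
  rw [fmode, norm_smul, mul_comm]
  gcongr
  exact norm_exp_freqForm_le k hz

lemma hasFDerivAt_fmode (v : (Fin n → ℤ) → Fin n → ℂ) (k : Fin n → ℤ) (z : Fin n → ℂ) :
    HasFDerivAt (fmode v k) (fmodeDeriv v k z) z :=
  (((freqForm k).hasFDerivAt.const_mul Complex.I).cexp).smul_const (v k)

lemma norm_fmodeDeriv_le {s σ : ℝ} (hσ : 0 < σ) (v : (Fin n → ℤ) → Fin n → ℂ) (k : Fin n → ℤ)
    {z : Fin n → ℂ} (hz : z ∈ strip n (s - σ)) :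
    ‖fmodeDeriv v k z‖ ≤ ‖v k‖ * Real.exp (knorm k * s) / σ := by
  rw [fmodeDeriv, ContinuousLinearMap.norm_smulRight_apply, norm_smul, norm_smul, Complex.norm_I,
    one_mul]
  calc _ ≤ Real.exp (knorm k * (s - σ)) * knorm k * ‖v k‖ := by
        gcongr
        exacts [norm_exp_freqForm_le k hz, norm_freqForm_le k]
    _ = (knorm k * Real.exp (knorm k * (s - σ))) * ‖v k‖ := by ring
    _ ≤ (Real.exp (knorm k * s) / σ) * ‖v k‖ := by gcongr; exact knorm_mul_exp_le hσ k
    _ = _ := by ring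

lemma norm_fmode_sub_le {s σ : ℝ} (hσ : 0 < σ) (v : (Fin n → ℤ) → Fin n → ℂ) (k : Fin n → ℤ)
    {z w : Fin n → ℂ} (hz : z ∈ strip n (s - σ)) (hw : w ∈ strip n (s - σ)) :
    ‖fmode v k z - fmode v k w‖ ≤ ‖v k‖ * Real.exp (knorm k * s) / σ * ‖z - w‖ :=
  Convex.norm_image_sub_le_of_norm_hasFDerivWithin_le
    (fun x _ => (hasFDerivAt_fmode v k x).hasFDerivWithinAt)
    (fun _ hx => norm_fmodeDeriv_le hσ v k hx) convex_strip hw hz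

end FourierModes

section FourierSeries

variable {n : ℕ} {s σ t : ℝ} {v : (Fin n → ℤ) → Fin n → ℂ}

lemma summable_fmode (h : vwnorm t v ≠ ⊤) {z : Fin n → ℂ} (hz : z ∈ strip n t) :
    Summable fun k => fmode v k z :=
  .of_norm_bounded (hasSum_vwnorm h).summable fun k => norm_fmode_le v k hz

lemma norm_fseries_le (h : vwnorm t v ≠ ⊤) {z : Fin n → ℂ} (hz : z ∈ strip n t) :
    ‖fseries v z‖ ≤ (vwnorm t v).toReal := by
  rw [fseries_eq_tsum_fmode]
  exact tsum_of_norm_bounded (hasSum_vwnorm h) fun k => norm_fmode_le v k hz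

lemma norm_fseries_sub_le (hσ : 0 < σ) (h : vwnorm s v ≠ ⊤) {z w : Fin n → ℂ}
    (hz : z ∈ strip n (s - σ)) (hw : w ∈ strip n (s - σ)) :
    ‖fseries v z - fseries v w‖ ≤ (vwnorm s v).toReal / σ * ‖z - w‖ := by
  have h' : vwnorm (s - σ) v ≠ ⊤ := ne_top_of_le_ne_top h (vwnorm_mono (by linarith) v)
  rw [fseries_eq_tsum_fmode, fseries_eq_tsum_fmode,
    ← (summable_fmode h' hz).tsum_sub (summable_fmode h' hw)]
  exact tsum_of_norm_bounded (((hasSum_vwnorm h).div_const σ).mul_right _)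
    fun k => norm_fmode_sub_le hσ v k hz hw

lemma exists_hasFDerivAt_fseries (hσ : 0 < σ) (h : vwnorm s v ≠ ⊤) {z : Fin n → ℂ}
    (hz : z ∈ ostrip n (s - σ)) :
    ∃ A : (Fin n → ℂ) →L[ℂ] (Fin n → ℂ),
      HasFDerivAt (fseries v) A z ∧ ‖A‖ ≤ (vwnorm s v).toReal / σ := by
  have h' : vwnorm (s - σ) v ≠ ⊤ := ne_top_of_le_ne_top h (vwnorm_mono (by linarith) v)
  have hsum := (hasSum_vwnorm h).div_const σ
  have hbound : ∀ k, ∀ x ∈ ostrip n (s - σ),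
      ‖fmodeDeriv v k x‖ ≤ ‖v k‖ * Real.exp (knorm k * s) / σ :=
    fun k x hx => norm_fmodeDeriv_le hσ v k (ostrip_subset_strip hx)
  refine ⟨∑' k, fmodeDeriv v k z, ?_, tsum_of_norm_bounded hsum fun k => hbound k z hz⟩
  rw [show fseries v = fun z => ∑' k, fmode v k z from funext (fseries_eq_tsum_fmode v)]
  exact hasFDerivAt_tsum_of_isPreconnected hsum.summable isOpen_ostrip
    convex_ostrip.isPreconnected (fun k x _ => hasFDerivAt_fmode v k x) hbound hz
    (summable_fmode h' (ostrip_subset_strip hz)) hz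

lemma fseries_add_two_pi (v : (Fin n → ℤ) → Fin n → ℂ) (z : Fin n → ℂ) (m : Fin n → ℤ) :
    fseries v (z + fun j => ((2 * Real.pi * (m j : ℝ) : ℝ) : ℂ)) = fseries v z := by
  unfold fseries
  congr 1 with k : 1
  congr 1
  rw [Complex.exp_eq_exp_iff_exists_int]
  refine ⟨∑ j, k j * m j, ?_⟩
  push_cast
  simp only [Pi.add_apply, mul_add, Finset.sum_add_distrib, Finset.mul_sum, Finset.sum_mul]
  congr 1
  refine Finset.sum_congr rfl fun j _ => ?_
  ring

lemma add_two_pi_mem_strip {z : Fin n → ℂ} (hz : z ∈ strip n t) (m : Fin n → ℤ) :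
    z + (fun j => ((2 * Real.pi * (m j : ℝ) : ℝ) : ℂ)) ∈ strip n t := by
  intro j
  simpa only [Pi.add_apply, Complex.add_im, Complex.ofReal_im, add_zero] using hz j

end FourierSeries

section PerturbedIdentity

lemma one_sub_mul_norm_sub_le {E : Type*} [NormedAddCommGroup E] {f : E → E} {L : ℝ} {x x' : E}
    (hf : ‖f x - f x'‖ ≤ L * ‖x - x'‖) :
    (1 - L) * ‖x - x'‖ ≤ ‖(x + f x) - (x' + f x')‖ := by
  have h := norm_sub_norm_le (x - x') (f x' - f x)
  rw [norm_sub_rev (f x'), show x - x' - (f x' - f x) = (x + f x) - (x' + f x') by abel] at h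
  linarith

/-- If `x ↦ y - f x` is a contraction mapping a nonempty closed set `S` to itself, then
`x + f x = y` has a solution in `S`. -/
lemma exists_add_eq_of_contraction {E : Type*} [NormedAddCommGroup E] [CompleteSpace E] {f : E → E}
    {L : ℝ} (hL0 : 0 ≤ L) (hL : L < 1) {S : Set E} (hS : IsClosed S) {x₀ y : E} (hx₀ : x₀ ∈ S)
    (hmaps : Set.MapsTo (fun x => y - f x) S S)
    (hf : ∀ x ∈ S, ∀ x' ∈ S, ‖f x - f x'‖ ≤ L * ‖x - x'‖) : ∃ x ∈ S, x + f x = y := by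
  have hc : ContractingWith ⟨L, hL0⟩ (hmaps.restrict (fun x => y - f x) S S) := by
    refine ⟨by exact_mod_cast hL, LipschitzWith.of_dist_le_mul fun a b => ?_⟩
    rw [Subtype.dist_eq, Subtype.dist_eq, dist_eq_norm, dist_eq_norm]
    change ‖(y - f a) - (y - f b)‖ ≤ L * ‖(a : E) - b‖
    rw [sub_sub_sub_cancel_left, norm_sub_rev]
    exact hf a a.2 b b.2
  obtain ⟨x, hx, hfix, -⟩ := hc.exists_fixedPoint' hS.isComplete hmaps hx₀ (edist_ne_top _ _)
  exact ⟨x, hx, (eq_sub_iff_add_eq.mp (Eq.symm hfix : x = y - f x))⟩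

/-- A local right inverse `g` of `id + f`, continuous at `y`, is differentiable there if `‖Df‖ ≤ L < 1/2`, and
its derivative is `2L`-close to the identity. -/
lemma exists_hasFDerivAt_inverse_id_add {E : Type*} [NormedAddCommGroup E] [NormedSpace ℂ E]
    [CompleteSpace E] {f g : E → E} {y : E} {A : E →L[ℂ] E} {L : ℝ} (hL : L < 1 / 2)
    (hA : ‖A‖ ≤ L) (hf : HasFDerivAt f A (g y)) (hg : ContinuousAt g y)
    (hinv : ∀ᶠ y' in nhds y, g y' + f (g y') = y') :
    ∃ B : E →L[ℂ] E, HasFDerivAt g B y ∧ ‖B - ContinuousLinearMap.id ℂ E‖ ≤ 2 * L := by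
  set u : (E →L[ℂ] E)ˣ := Units.oneSub (-A) (by rw [norm_neg]; linarith)
  have hu : (u : E →L[ℂ] E) = ContinuousLinearMap.id ℂ E + A := by
    simp [u, ← ContinuousLinearMap.one_def]
  refine ⟨(ContinuousLinearEquiv.unitsEquiv ℂ E u).symm, HasFDerivAt.of_local_left_inverse
    (f := fun x => x + f x) hg ?_ hinv, ?_⟩
  · have h := (hasFDerivAt_id (g y)).add hf
    rw [← hu] at h
    exact h
  · have hB : (((ContinuousLinearEquiv.unitsEquiv ℂ E u).symm : E ≃L[ℂ] E) : E →L[ℂ] E) =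
        ((u⁻¹ : (E →L[ℂ] E)ˣ) : E →L[ℂ] E) := rfl
    rw [hB, ← ContinuousLinearMap.one_def]
    set B : E →L[ℂ] E := ((u⁻¹ : (E →L[ℂ] E)ˣ) : E →L[ℂ] E)
    have h1 : (1 + A) * B = 1 := by
      rw [ContinuousLinearMap.one_def, ← hu, ← ContinuousLinearMap.one_def]
      exact u.mul_inv
    have h2 : B - 1 = -(A * (B - 1)) - A := by
      rw [add_mul, one_mul] at h1
      rw [mul_sub, mul_one, ← h1]
      abel
    have h3 : ‖B - 1‖ ≤ L * ‖B - 1‖ + L := by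
      calc ‖B - 1‖ = ‖-(A * (B - 1)) - A‖ := by rw [← h2]
        _ ≤ ‖A * (B - 1)‖ + ‖A‖ := by simpa using norm_sub_le (-(A * (B - 1))) A
        _ ≤ ‖A‖ * ‖B - 1‖ + ‖A‖ := by gcongr; exact norm_mul_le _ _
        _ ≤ L * ‖B - 1‖ + L := by gcongr
    nlinarith [norm_nonneg (B - 1)]

end PerturbedIdentity

/-- **Theorem B.1** (inversion of a periodic holomorphism of a complex strip, lifted
form).  If `|v|_s < σ/n` then `φ = id + v` is injective on `S_{s−σ}`, every point of
`S_{s−2σ}` has a unique `φ`-preimage in `S_{s−σ}`, and the resulting inverse `ψ`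
commutes with the translations by `2πℤⁿ`, satisfies `‖ψ − id‖_∞ ≤ |v|_{s−σ}`, and, if
moreover `|v|_s < σ/(2n)`, is holomorphic on the open strip of width `s−2σ` with
`‖Dψ − Id‖ ≤ (2/σ)|v|_s` there. -/
theorem inversion_of_strip_holomorphism (n : ℕ) (hn : 1 ≤ n) (s σ : ℝ)
    (hσ : 0 < σ) (h2σ : 2 * σ < s) (v : (Fin n → ℤ) → Fin n → ℂ)
    (hv : vwnorm s v < ENNReal.ofReal (σ / n)) :
    Set.InjOn (fun z => z + fseries v z) (strip n (s - σ)) ∧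
    (∀ y ∈ strip n (s - 2 * σ),
      ∃! x : Fin n → ℂ, x ∈ strip n (s - σ) ∧ x + fseries v x = y) ∧
    ∃ ψ : (Fin n → ℂ) → Fin n → ℂ,
      (∀ y ∈ strip n (s - 2 * σ), ψ y ∈ strip n (s - σ) ∧ ψ y + fseries v (ψ y) = y) ∧
      (∀ y ∈ strip n (s - 2 * σ), ∀ k : Fin n → ℤ,
        ψ (y + fun j => ((2 * Real.pi * (k j : ℝ) : ℝ) : ℂ)) =
          ψ y + fun j => ((2 * Real.pi * (k j : ℝ) : ℝ) : ℂ)) ∧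
      (∀ y ∈ strip n (s - 2 * σ), ‖ψ y - y‖ ≤ (vwnorm (s - σ) v).toReal) ∧
      (vwnorm s v < ENNReal.ofReal (σ / (2 * n)) →
        DifferentiableOn ℂ ψ (ostrip n (s - 2 * σ)) ∧
        ∀ y ∈ ostrip n (s - 2 * σ),
          ‖fderiv ℂ ψ y - ContinuousLinearMap.id ℂ (Fin n → ℂ)‖ ≤
            2 / σ * (vwnorm s v).toReal) := by
  have hn' : (1 : ℝ) ≤ n := by exact_mod_cast hn
  have htop : vwnorm s v ≠ ⊤ := hv.ne_top
  have hmono : vwnorm (s - σ) v ≤ vwnorm s v := vwnorm_mono (by linarith) v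
  have htop' : vwnorm (s - σ) v ≠ ⊤ := ne_top_of_le_ne_top htop hmono
  have hV : (vwnorm s v).toReal < σ :=
    (ENNReal.toReal_lt_of_lt_ofReal hv).trans_le (div_le_self hσ.le hn')
  have hV' : (vwnorm (s - σ) v).toReal < σ := (ENNReal.toReal_mono htop hmono).trans_lt hV
  set L : ℝ := (vwnorm s v).toReal / σ
  have hL0 : 0 ≤ L := div_nonneg ENNReal.toReal_nonneg hσ.le
  have hL1 : L < 1 := (div_lt_one hσ).2 hV
  have hlip : ∀ z ∈ strip n (s - σ), ∀ w ∈ strip n (s - σ),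
      ‖fseries v z - fseries v w‖ ≤ L * ‖z - w‖ :=
    fun z hz w hw => norm_fseries_sub_le hσ htop hz hw
  have hinj : Set.InjOn (fun z => z + fseries v z) (strip n (s - σ)) := by
    intro z hz w hw hzw
    have h := one_sub_mul_norm_sub_le (hlip z hz w hw)
    rw [sub_eq_zero.2 (show z + fseries v z = w + fseries v w from hzw), norm_zero] at h
    exact sub_eq_zero.1 (norm_le_zero_iff.1 (by nlinarith [norm_nonneg (z - w)]))
  have hsub : strip n (s - 2 * σ) ⊆ strip n (s - σ) := fun z hz j => (hz j).trans (by linarith)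
  have hex : ∀ y ∈ strip n (s - 2 * σ), ∃ x ∈ strip n (s - σ), x + fseries v x = y := by
    intro y hy
    refine exists_add_eq_of_contraction hL0 hL1 isClosed_strip (hsub hy) (fun x hx j => ?_) hlip
    have h1 := abs_im_le_abs_im_add_norm_sub (y - fseries v x) y j
    rw [sub_sub_cancel_left, norm_neg] at h1
    linarith [hy j, norm_fseries_le htop' hx]
  choose! ψ hψ using hex
  have hψ_sub : ∀ y ∈ strip n (s - 2 * σ), ‖ψ y - y‖ ≤ (vwnorm (s - σ) v).toReal := by
    intro y hy
    have h : ψ y - y = -fseries v (ψ y) := by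
      nth_rewrite 2 [← (hψ y hy).2]
      abel
    rw [h, norm_neg]
    exact norm_fseries_le htop' (hψ y hy).1
  refine ⟨hinj, fun y hy => ⟨ψ y, hψ y hy, fun x hx => hinj hx.1 (hψ y hy).1
    (hx.2.trans (hψ y hy).2.symm)⟩, ψ, hψ, fun y hy k => ?_, hψ_sub, fun hv2 => ?_⟩
  · refine hinj (hψ _ (add_two_pi_mem_strip hy k)).1 (add_two_pi_mem_strip (hψ y hy).1 k) ?_
    simp only [(hψ _ (add_two_pi_mem_strip hy k)).2, fseries_add_two_pi]
    rw [add_right_comm, (hψ y hy).2]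
  · have hL2 : L < 1 / 2 := by
      rw [div_lt_iff₀ hσ]
      refine (ENNReal.toReal_lt_of_lt_ofReal hv2).trans_le ?_
      rw [div_le_iff₀ (by positivity)]
      nlinarith
    have hderiv : ∀ y ∈ ostrip n (s - 2 * σ), ∃ B : (Fin n → ℂ) →L[ℂ] (Fin n → ℂ),
        HasFDerivAt ψ B y ∧ ‖B - ContinuousLinearMap.id ℂ (Fin n → ℂ)‖ ≤ 2 * L := by
      intro y hy
      have hyS := ostrip_subset_strip hy
      have hnhds : strip n (s - 2 * σ) ∈ nhds y :=
        Filter.mem_of_superset (isOpen_ostrip.mem_nhds hy) ostrip_subset_strip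
      have hψy : ψ y ∈ ostrip n (s - σ) := fun j => by
        linarith [abs_im_le_abs_im_add_norm_sub (ψ y) y j, hy j, hψ_sub y hyS]
      obtain ⟨A, hA, hAL⟩ := exists_hasFDerivAt_fseries hσ htop hψy
      refine exists_hasFDerivAt_inverse_id_add hL2 hAL hA ?_
        (Filter.mem_of_superset hnhds fun y' hy' => (hψ y' hy').2)
      have hLip : LipschitzOnWith 2 ψ (strip n (s - 2 * σ)) := by
        refine LipschitzOnWith.of_dist_le_mul fun a ha b hb => ?_
        have h := one_sub_mul_norm_sub_le (hlip _ (hψ a ha).1 _ (hψ b hb).1)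
        rw [(hψ a ha).2, (hψ b hb).2] at h
        rw [dist_eq_norm, dist_eq_norm, NNReal.coe_ofNat]
        nlinarith [norm_nonneg (ψ a - ψ b)]
      exact hLip.continuousOn.continuousAt hnhds
    refine ⟨fun y hy => ?_, fun y hy => ?_⟩
    · obtain ⟨B, hB, -⟩ := hderiv y hy
      exact hB.differentiableAt.differentiableWithinAt
    · obtain ⟨B, hB, hBL⟩ := hderiv y hy
      rw [hB.fderiv, div_mul_eq_mul_div, mul_div_assoc]
      exact hBL
end
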